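/- Let F be the global map of ECA rule 14 and take the symmetric Bernoulli initial measure μ_{1/2}. Then for every n ≥ 1: P_n(0) = (1/2)·(1 + (2n−1)·C_{n−1}/4^n); P_n(00) = 2^{−2−2n}·(n+1)·C_n + 1/4; P_n(000) = 2^{−2n−3}·(4n+3)·C_n; and P_n(010) = 2^{−2−2n}·(n+1)·C_n, where C_k denotes the k-th Catalan number. -/

import Mathlib

open MeasureTheory

/-- The cylinder set generated by the binary word `b` (anchored at `0`). -/
def cylinder (b : List Bool) : Set (ℤ → Bool) :=
  {x | ∀ j : Fin b.length, x (j.val : ℤ) = b.get j}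

/-- The global map of the elementary cellular automaton with local rule `f`. -/
def eca (f : Bool → Bool → Bool → Bool) (x : ℤ → Bool) : ℤ → Bool :=
  fun i => f (x (i - 1)) (x i) (x (i + 1))

/-- The local rule of ECA rule 14: `f(x1,x2,x3) = 1` exactly for
`(x1,x2,x3) ∈ {(0,0,1),(0,1,0),(0,1,1)}`. -/
def rule14 (x1 x2 x3 : Bool) : Bool := !x1 && (x2 || x3)

/-- `μ` is the Bernoulli (i.i.d. product) measure with parameter `p`. -/
def IsBernoulli (p : ℝ) (μ : Measure (ℤ → Bool)) : Prop :=
  ∀ (s : Finset ℤ) (f : ℤ → Bool),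
    μ {x | ∀ i ∈ s, x i = f i} =
      ∏ i ∈ s, (if f i then ENNReal.ofReal p else ENNReal.ofReal (1 - p))

/-- Walk predicate: starting at position `b` with room `h` and `c` changes still needed. -/
def GW (x : ℤ → Bool) : ℤ → ℕ → ℕ → Prop
  | _, _, 0 => False
  | _, 0, _ + 1 => True
  | b, c + 1, h + 1 =>
      (x (b + 1) = x b ∧ GW x (b + 1) (c + 1) h) ∨ (x (b + 1) = !x b ∧ GW x (b + 1) c (h + 2))
termination_by _ c h => (c, h)

lemma GW_zero (x : ℤ → Bool) (b : ℤ) (c : ℕ) : GW x b c 0 ↔ False := by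
  cases c <;> simp [GW]

lemma GW_zero' (x : ℤ → Bool) (b : ℤ) (h : ℕ) : GW x b 0 (h + 1) ↔ True := by
  simp [GW]

lemma GW_succ (x : ℤ → Bool) (b : ℤ) (c h : ℕ) : GW x b (c + 1) (h + 1) ↔
      (x (b + 1) = x b ∧ GW x (b + 1) (c + 1) h) ∨
        (x (b + 1) = !x b ∧ GW x (b + 1) c (h + 2)) := by
  rw [GW]

lemma GW_same {x : ℤ → Bool} {b b' : ℤ} (hb : b' = b + 1) {u : Bool} (h1 : x b = u) (h2 : x b' = u)
    (c h : ℕ) : GW x b (c + 1) (h + 1) ↔ GW x b' (c + 1) h := by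
  subst hb
  rw [GW_succ]; simp [h1, h2]

lemma GW_diff {x : ℤ → Bool} {b b' : ℤ} (hb : b' = b + 1) {u : Bool} (h1 : x b = u)
    (h2 : x b' = !u) (c h : ℕ) : GW x b (c + 1) (h + 1) ↔ GW x b' c (h + 2) := by
  subst hb
  rw [GW_succ]; simp [h1, h2]

lemma eca14 (x : ℤ → Bool) (i : ℤ) :
    eca rule14 x i = (!x (i - 1) && (x i || x (i + 1))) := rfl

lemma eca14' (x : ℤ → Bool) (i j k : ℤ) (hj : j = i + 1) (hk : k = i + 2) :
    eca rule14 x j = (!x i && (x j || x k)) := by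
  subst hj hk
  rw [eca14]
  rw [show i + 1 - 1 = i by ring, show i + 1 + 1 = i + 2 by ring]

/-- synchronisation of the walks of `x` and of its image -/
lemma GW_sync (x : ℤ → Bool) : ∀ N t h : ℕ, 4 * t + h = N → ∀ j : ℤ,
    (x j = true → (GW (eca rule14 x) (j + 1) (2 * t + 1) h ↔ GW x j (2 * t + 2) h)) ∧
    (x j = false → x (j + 1) = false → eca rule14 x j = false →
      (GW (eca rule14 x) j (2 * t + 1) h ↔ GW x j (2 * t + 1) (h + 1))) := by
  intro N
  induction N using Nat.strong_induction_on with
  | _ N ih =>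
  intro t h hN j
  have y1 := eca14' x j (j + 1) (j + 2) rfl rfl
  have y2 := eca14' x (j + 1) (j + 2) (j + 3) (by ring) (by ring)
  have y3 := eca14' x (j + 2) (j + 3) (j + 4) (by ring) (by ring)
  have hB : ∀ j : ℤ, (x j = false → x (j + 1) = false → eca rule14 x j = false →
      (GW (eca rule14 x) j (2 * t + 1) h ↔ GW x j (2 * t + 1) (h + 1))) := by
    intro j h0 h1 h2
    have y1 := eca14' x j (j + 1) (j + 2) rfl rfl
    have y2 := eca14' x (j + 1) (j + 2) (j + 3) (by ring) (by ring)
    have y3 := eca14' x (j + 2) (j + 3) (j + 4) (by ring) (by ring)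
    rw [GW_same (x := x) rfl h0 h1]
    rcases h with _ | h
    · simp [GW_zero]
    cases h3 : x (j + 2) with
    | false =>
      simp only [h0, h1, h3] at y1
      rw [GW_same rfl h2 (by simpa using y1)]
      exact (ih (4 * t + h) (by omega) t h rfl (j + 1)).2 h1 (by rw [← h3]; congr 1; ring)
        (by simpa using y1)
    | true =>
      simp only [h0, h1, h3] at y1 y2 y3
      simp at y1 y2 y3
      rw [GW_diff rfl h2 (by simpa using y1), GW_diff (b' := j + 2) (by ring) h1 (by simpa using h3)]
      rcases t with _ | t
      · simp [GW_zero']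
      · rw [show 2 * (t + 1) = (2 * t + 1) + 1 by ring, GW_same (b' := j + 2) (by ring) y1 y2,
          GW_diff (b' := j + 3) (by ring) y2 (by simpa using y3)]
        have := (ih (4 * t + (h + 2)) (by omega) t (h + 2) rfl (j + 2)).1 h3
        rw [show j + 2 + 1 = j + 3 by ring] at this
        exact this
  refine ⟨fun h0 => ?_, hB j⟩
  rcases h with _ | h
  · simp [GW_zero]
  simp only [h0] at y1
  simp at y1
  cases h1 : x (j + 1) with
  | true =>
    simp only [h1] at y2
    simp at y2
    rw [GW_same (x := x) rfl h0 h1, GW_same (b' := j + 2) (by ring) y1 y2]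
    have := (ih (4 * t + h) (by omega) t h rfl (j + 1)).1 h1
    rw [show j + 1 + 1 = j + 2 by ring] at this
    exact this
  | false =>
    rw [GW_diff (x := x) rfl h0 (by simpa using h1)]
    cases h2 : x (j + 2) with
    | false =>
      exact hB (j + 1) h1 (by rw [← h2]; congr 1; ring) y1
    | true =>
      simp only [h1, h2] at y2 y3
      simp at y2 y3
      rw [GW_diff (b' := j + 2) (by ring) y1 (by simpa using y2),
        GW_diff (x := x) (b' := j + 2) (by ring) h1 (by simpa using h2)]
      rcases t with _ | t
      · simp [GW_zero']
      · rw [show 2 * (t + 1) = (2 * t + 1) + 1 by ring,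
          GW_diff (b' := j + 3) (by ring) y2 (by simpa using y3)]
        have := (ih (4 * t + (h + 3)) (by omega) t (h + 3) rfl (j + 2)).1 h2
        rw [show j + 2 + 1 = j + 3 by ring] at this
        exact this

lemma GW_sync' (x : ℤ → Bool) (c h : ℕ) (hc : Odd c) (j : ℤ) (hj : x j = true) :
    GW (eca rule14 x) (j + 1) c h ↔ GW x j (c + 1) h := by
  obtain ⟨t, rfl⟩ := hc
  exact (GW_sync x _ t h rfl j).1 hj

/-- characterisation of the preimages of `010` -/
lemma iter_010 (n : ℕ) : ∀ (x : ℤ → Bool) (i : ℤ),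
    ((eca rule14)^[n + 1] x i = false ∧ (eca rule14)^[n + 1] x (i + 1) = true ∧
      (eca rule14)^[n + 1] x (i + 2) = false) ↔
    (x (i - (n + 1)) = decide (Even n) ∧ x (i - n) = !decide (Even n) ∧
      GW x (i - n) (n + 1) 1) := by
  induction n with
  | zero =>
    intro x i
    have y0 := eca14' x (i - 1) i (i + 1) (by ring) (by ring)
    have y1 := eca14' x i (i + 1) (i + 2) (by ring) (by ring)
    have y2 := eca14' x (i + 1) (i + 2) (i + 3) (by ring) (by ring)
    rw [GW_succ]
    simp [GW_zero, GW_zero', y0, y1, y2]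
    cases x (i - 1) <;> cases x i <;> cases x (i + 1) <;> cases x (i + 2) <;> simp
  | succ n ih =>
    intro x i
    rw [Function.iterate_succ, Function.comp_apply, ih]
    push_cast
    generalize hp : i - ((n : ℤ) + 1) = p
    have e1 : i - (n : ℤ) = p + 1 := by rw [← hp]; ring
    have e2 : i - ((n : ℤ) + 1 + 1) = p - 1 := by rw [← hp]; ring
    rw [e1, e2]
    have y0 := eca14' x (p - 1) p (p + 1) (by ring) (by ring)
    have y1 := eca14' x p (p + 1) (p + 2) (by ring) (by ring)
    have y2 := eca14' x (p + 1) (p + 2) (p + 3) (by ring) (by ring)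
    by_cases hn : Even n
    · have hodd : Odd (n + 1) := hn.add_one
      have hne : ¬ Even (n + 1) := Nat.not_even_iff_odd.mpr hodd
      have hs := GW_sync' x (n + 1) 1 hodd p
      simp only [hn, hne, decide_true, decide_false]
      rw [y0, y1]
      cases h1 : x p
      · cases x (p - 1) <;> cases x (p + 1) <;> cases x (p + 2) <;> simp
      · simp [hs h1]
    · have hev : Even (n + 1) := Nat.even_add_one.mpr hn
      have hodd : Odd n := Nat.not_even_iff_odd.mp hn
      have hs := GW_sync' x n 2 hodd (p + 1)
      simp only [hn, hev, decide_true, decide_false]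
      rw [GW_succ, GW_succ x]
      simp only [GW_zero, and_false, false_or]
      rw [show p + 1 + 1 = p + 2 by ring] at *
      rw [y0, y1, y2]
      cases h1 : x (p + 1)
      · cases x p <;> cases x (p - 1) <;> cases x (p + 2) <;> cases x (p + 3) <;> simp
      · cases x p <;> cases x (p - 1) <;> simp [hs h1]

/-- the count of good walks -/
def DC (c h : ℕ) : ℕ := ∑ u ∈ Finset.range h, (2 * c + h - 1).choose (c + u)

lemma DC_rec (c h : ℕ) : DC (c + 1) (h + 1) = DC (c + 1) h + DC c (h + 2) := by
  unfold DC
  have e1 : 2 * (c + 1) + (h + 1) - 1 = (2 * c + h + 1) + 1 := by omega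
  have e2 : 2 * (c + 1) + h - 1 = 2 * c + h + 1 := by omega
  have e3 : 2 * c + (h + 2) - 1 = 2 * c + h + 1 := by omega
  rw [e1, e2, e3]
  have : ∀ u, (2 * c + h + 1 + 1).choose (c + 1 + u) =
      (2 * c + h + 1).choose (c + u) + (2 * c + h + 1).choose (c + 1 + u) := by
    intro u
    rw [show c + 1 + u = (c + u) + 1 by ring, Nat.choose_succ_succ]
  simp only [this, Finset.sum_add_distrib]
  rw [Finset.sum_range_succ (fun u => (2 * c + h + 1).choose (c + 1 + u)),
    Finset.sum_range_succ _ (h + 1)]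
  rw [show c + 1 + h = c + (h + 1) by ring]
  ring

lemma DC_zero (h : ℕ) : DC 0 (h + 1) = 2 ^ h := by
  unfold DC
  simpa using Nat.sum_range_choose h

lemma DC_one (n : ℕ) : DC n 1 = n.centralBinom := by
  simp [DC, Nat.centralBinom]

section meas
variable (μ : Measure (ℤ → Bool))

lemma ber_real (hber : IsBernoulli (1 / 2) μ) (s : Finset ℤ) (f : ℤ → Bool) :
    μ.real {x | ∀ i ∈ s, x i = f i} = (1 / 2) ^ s.card := by
  rw [Measure.real, hber s f, ENNReal.toReal_prod, Finset.prod_congr rfl (g := fun _ => (1/2 : ℝ))]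
  · simp
  · intro i _
    split_ifs
    · exact ENNReal.toReal_ofReal (by norm_num)
    · rw [ENNReal.toReal_ofReal (by norm_num)]; norm_num

lemma meas_coord (i : ℤ) (u : Bool) : MeasurableSet {x : ℤ → Bool | x i = u} :=
  measurableSet_eq_fun (measurable_pi_apply i) measurable_const

lemma meas_GW (hprob : IsProbabilityMeasure μ) (hber : IsBernoulli (1 / 2) μ) (c h : ℕ) :
    ∀ (s : Finset ℤ) (f : ℤ → Bool) (b : ℤ), b ∈ s → (∀ i, b < i → i ∉ s) →
    μ.real {x | (∀ i ∈ s, x i = f i) ∧ GW x b c h} =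
      (1 / 2) ^ s.card * (DC c h / 2 ^ (2 * c + h - 1)) := by
  induction c generalizing h with
  | zero =>
    intro s f b hb hs
    cases h with
    | zero => simp [GW_zero, DC]
    | succ h => simp [GW_zero', DC_zero, ber_real μ hber]
  | succ c ihc =>
    induction h with
    | zero => intro s f b hb hs; simp [GW_zero, DC]
    | succ h ihh =>
      intro s f b hb hs
      have hnot : b + 1 ∉ s := hs _ (by omega)
      have key : ∀ u c h, {x | (∀ i ∈ insert (b + 1) s, x i = Function.update f (b + 1) u i) ∧
          GW x (b + 1) c h} = {x | (∀ i ∈ s, x i = f i) ∧ x (b + 1) = u ∧ GW x (b + 1) c h} := by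
        intro u c h
        ext x
        simp only [Set.mem_ofPred_eq, Finset.forall_mem_insert, Function.update_self]
        have : (∀ i ∈ s, x i = Function.update f (b + 1) u i) ↔ ∀ i ∈ s, x i = f i := by
          refine forall₂_congr fun i hi => ?_
          rw [Function.update_of_ne]
          rintro rfl; exact hnot hi
        rw [this]; tauto
      have hb' : b + 1 ∈ insert (b + 1) s := Finset.mem_insert_self _ _
      have hs' : ∀ i, b + 1 < i → i ∉ insert (b + 1) s := by
        intro i hi hmem
        rcases Finset.mem_insert.mp hmem with h | h
        · omega
        · exact hs i (by omega) h
      have k1 := ihh _ (Function.update f (b + 1) (f b)) (b + 1) hb' hs'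
      have k2 := ihc (h + 2) _ (Function.update f (b + 1) (!f b)) (b + 1) hb' hs'
      rw [key, Finset.card_insert_of_notMem hnot] at k1 k2
      rw [← measureReal_inter_add_sdiff (μ := μ) (meas_coord (b + 1) (f b))]
      have s1 : {x | (∀ i ∈ s, x i = f i) ∧ GW x b (c + 1) (h + 1)} ∩ {x | x (b + 1) = f b} =
          {x | (∀ i ∈ s, x i = f i) ∧ x (b + 1) = f b ∧ GW x (b + 1) (c + 1) h} := by
        ext x
        simp only [Set.mem_inter_iff, Set.mem_ofPred_eq, GW_succ]
        constructor
        · rintro ⟨⟨h1, h2⟩, h3⟩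
          simp_all
        · rintro ⟨h1, h2, h3⟩
          have := h1 b hb
          exact ⟨⟨h1, Or.inl ⟨by rw [h2, this], h3⟩⟩, h2⟩
      have s2 : {x | (∀ i ∈ s, x i = f i) ∧ GW x b (c + 1) (h + 1)} \ {x | x (b + 1) = f b} =
          {x | (∀ i ∈ s, x i = f i) ∧ x (b + 1) = (!f b) ∧ GW x (b + 1) c (h + 2)} := by
        ext x
        simp only [Set.mem_sdiff, Set.mem_ofPred_eq, GW_succ]
        constructor
        · rintro ⟨⟨h1, h2⟩, h3⟩
          simp_all
        · rintro ⟨h1, h2, h3⟩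
          have := h1 b hb
          exact ⟨⟨h1, Or.inr ⟨by rw [h2, this], h3⟩⟩, by rw [h2]; simp⟩
      rw [s1, s2, k1, k2, DC_rec]
      have e1 : 2 * (c + 1) + (h + 1) - 1 = (2 * c + h + 1) + 1 := by omega
      have e2 : 2 * (c + 1) + h - 1 = 2 * c + h + 1 := by omega
      have e3 : 2 * c + (h + 2) - 1 = 2 * c + h + 1 := by omega
      rw [e1, e2, e3]
      push_cast
      field_simp
      ring

lemma meas_010 (hprob : IsProbabilityMeasure μ) (hber : IsBernoulli (1 / 2) μ) (n : ℕ) :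
    μ.real {x | (eca rule14)^[n + 1] x 0 = false ∧ (eca rule14)^[n + 1] x 1 = true ∧
      (eca rule14)^[n + 1] x 2 = false} = (n + 1).centralBinom / 4 ^ (n + 2) := by
  have h := iter_010 n
  let a : ℤ := 0 - ((n : ℤ) + 1)
  let b : ℤ := 0 - (n : ℤ)
  have hab : a < b := by simp only [a, b]; omega
  have := meas_GW μ hprob hber (n + 1) 1 {a, b} (fun i => if i = a then decide (Even n) else
    !decide (Even n)) b (by simp) (by intro i hi; simp; omega)
  rw [Finset.card_pair hab.ne, DC_one] at this
  have e : {x | (eca rule14)^[n + 1] x 0 = false ∧ (eca rule14)^[n + 1] x 1 = true ∧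
      (eca rule14)^[n + 1] x 2 = false} = {x | (∀ i ∈ ({a, b} : Finset ℤ), x i =
        (if i = a then decide (Even n) else !decide (Even n))) ∧ GW x b (n + 1) 1} := by
    ext x
    have := h x 0
    simp only [zero_add] at this
    simp only [Set.mem_ofPred_eq]
    rw [this]
    simp [a, b, and_assoc]
  rw [e, this, show 2 * (n + 1) + 1 - 1 = 2 * (n + 1) by omega, pow_mul]
  norm_num [pow_succ]
  field_simp

end meas

/-- the shift -/
def shZ (x : ℤ → Bool) : ℤ → Bool := fun i => x (i + 1)

lemma measurable_shZ : Measurable shZ := measurable_pi_iff.mpr fun i => measurable_pi_apply (i + 1)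

lemma measurable_eca14 : Measurable (eca rule14) := by
  refine measurable_pi_iff.mpr fun i => ?_
  have h : Measurable (fun p : Bool × Bool × Bool => rule14 p.1 p.2.1 p.2.2) :=
    measurable_of_finite _
  have h2 : Measurable (fun x : ℤ → Bool => (x (i - 1), x i, x (i + 1))) :=
    (measurable_pi_apply (i - 1)).prodMk
      ((measurable_pi_apply i).prodMk (measurable_pi_apply (i + 1)))
  exact h.comp h2

lemma shZ_eca (x : ℤ → Bool) : shZ (eca rule14 x) = eca rule14 (shZ x) := by
  funext i
  simp only [shZ, eca]
  rw [show i + 1 - 1 = i - 1 + 1 by ring]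

lemma meas_cyl (s : Finset ℤ) (f : ℤ → Bool) :
    MeasurableSet {x : ℤ → Bool | ∀ i ∈ s, x i = f i} := by
  have : {x : ℤ → Bool | ∀ i ∈ s, x i = f i} = ⋂ i ∈ s, {x | x i = f i} := by
    ext x; simp
  rw [this]
  exact Finset.measurableSet_biInter _ fun i _ => meas_coord i (f i)

lemma gen_cyl : (inferInstance : MeasurableSpace (ℤ → Bool)) = MeasurableSpace.generateFrom
    {A | A = ∅ ∨ ∃ (s : Finset ℤ) (f : ℤ → Bool), A = {x | ∀ i ∈ s, x i = f i}} := by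
  apply le_antisymm
  · change MeasurableSpace.pi ≤ _
    refine iSup_le fun i => ?_
    rw [← measurable_iff_comap_le]
    refine @measurable_to_countable' _ _ _ _ (_) _ fun u => ?_
    apply MeasurableSpace.measurableSet_generateFrom
    right
    refine ⟨{i}, fun _ => u, ?_⟩
    ext x; simp
  · apply MeasurableSpace.generateFrom_le
    rintro A (rfl | ⟨s, f, rfl⟩)
    · exact MeasurableSet.empty
    · exact meas_cyl s f

lemma pi_cyl : IsPiSystem
    {A : Set (ℤ → Bool) | A = ∅ ∨ ∃ (s : Finset ℤ) (f : ℤ → Bool), A = {x | ∀ i ∈ s, x i = f i}} := by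
  rintro A (rfl | ⟨s, f, rfl⟩) B (rfl | ⟨t, g, rfl⟩) hne
  · simp
  · simp
  · simp
  · right
    obtain ⟨z, hz1, hz2⟩ := hne
    refine ⟨s ∪ t, z, ?_⟩
    ext x
    simp only [Set.mem_inter_iff, Set.mem_ofPred_eq, Finset.mem_union] at *
    constructor
    · rintro ⟨h1, h2⟩ i (hi | hi)
      · rw [h1 i hi, hz1 i hi]
      · rw [h2 i hi, hz2 i hi]
    · intro h
      exact ⟨fun i hi => by rw [h i (Or.inl hi), hz1 i hi],
        fun i hi => by rw [h i (Or.inr hi), hz2 i hi]⟩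

lemma map_shZ (μ : Measure (ℤ → Bool)) (hprob : IsProbabilityMeasure μ)
    (hber : IsBernoulli (1 / 2) μ) : μ.map shZ = μ := by
  symm
  refine ext_of_generate_finite _ gen_cyl pi_cyl ?_ ?_
  · rintro A (rfl | ⟨s, f, rfl⟩)
    · simp
    · rw [Measure.map_apply measurable_shZ]
      · have : shZ ⁻¹' {x | ∀ i ∈ s, x i = f i} =
            {x | ∀ i ∈ s.map (Equiv.addRight (1 : ℤ)).toEmbedding, x i = f (i - 1)} := by
          ext x
          simp only [Set.mem_preimage, Set.mem_ofPred_eq, Finset.mem_map, shZ]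
          constructor
          · rintro h i ⟨j, hj, rfl⟩
            simpa using h j hj
          · intro h i hi
            simpa using h (i + 1) ⟨i, hi, by simp⟩
        rw [this, hber, hber]
        simp
      · exact meas_cyl s f
  · rw [Measure.map_apply measurable_shZ MeasurableSet.univ, Set.preimage_univ]

/-- shift-invariant probability measures -/
structure SInv (ν : Measure (ℤ → Bool)) : Prop where
  prob : IsProbabilityMeasure ν
  inv : ν.map shZ = ν

lemma SInv.step {ν : Measure (ℤ → Bool)} (h : SInv ν) : SInv (ν.map (eca rule14)) := by
  have := h.prob
  refine ⟨Measure.isProbabilityMeasure_map measurable_eca14.aemeasurable, ?_⟩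
  rw [Measure.map_map measurable_shZ measurable_eca14]
  have : shZ ∘ eca rule14 = eca rule14 ∘ shZ := funext shZ_eca
  rw [this, ← Measure.map_map measurable_eca14 measurable_shZ, h.inv]

lemma meas_two (i j : ℤ) (u v : Bool) : MeasurableSet {x : ℤ → Bool | x i = u ∧ x j = v} :=
  (meas_coord i u).inter (meas_coord j v)

lemma meas_three (i j k : ℤ) (u v w : Bool) :
    MeasurableSet {x : ℤ → Bool | x i = u ∧ x j = v ∧ x k = w} :=
  (meas_coord i u).inter (meas_two j k v w)

lemma SInv.one {ν : Measure (ℤ → Bool)} (h : SInv ν) (i : ℤ) (u : Bool) :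
    ν.real {x | x (i + 1) = u} = ν.real {x | x i = u} := by
  conv_rhs => rw [← h.inv]
  rw [map_measureReal_apply measurable_shZ (meas_coord _ _)]
  rfl

lemma SInv.three {ν : Measure (ℤ → Bool)} (h : SInv ν) (i j k : ℤ) (u v w : Bool) :
    ν.real {x | x (i + 1) = u ∧ x (j + 1) = v ∧ x (k + 1) = w} =
      ν.real {x | x i = u ∧ x j = v ∧ x k = w} := by
  conv_rhs => rw [← h.inv]
  rw [map_measureReal_apply measurable_shZ (meas_three _ _ _ _ _ _)]
  rfl

/-- split a set according to the value of one coordinate -/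
lemma split_coord {ν : Measure (ℤ → Bool)} (hp : IsProbabilityMeasure ν)
    (i : ℤ) {p q r : (ℤ → Bool) → Prop} (hq : ∀ x, q x ↔ p x ∧ x i = true)
    (hr : ∀ x, r x ↔ p x ∧ x i = false) :
    ν.real {x | p x} = ν.real {x | q x} + ν.real {x | r x} := by
  rw [← measureReal_inter_add_sdiff (μ := ν) (meas_coord i true)]
  congr 2
  · ext x; simp [hq]
  · ext x; simp [hr]

lemma step_01 {ν : Measure (ℤ → Bool)} (h : SInv ν) :
    (ν.map (eca rule14)).real {x | x 0 = false ∧ x 1 = true} =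
      ν.real {x | x 0 = false ∧ x 1 = true} := by
  have := h.prob
  rw [map_measureReal_apply measurable_eca14 (meas_two _ _ _ _)]
  have e : eca rule14 ⁻¹' {x | x 0 = false ∧ x 1 = true} =
      {x | x (-1) = true ∧ x 0 = false ∧ x 1 = true} ∪
      {x | x (-1 + 1) = false ∧ x (0 + 1) = false ∧ x (1 + 1) = true} := by
    ext x
    simp only [Set.mem_preimage, Set.mem_ofPred_eq, Set.mem_union]
    have y0 := eca14' x (-1) 0 1 (by ring) (by ring)
    have y1 := eca14' x 0 1 2 (by ring) (by ring)
    norm_num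
    rw [y0, y1]
    cases x (-1) <;> cases x 0 <;> cases x 1 <;> simp
  rw [e, measureReal_union _ (meas_three _ _ _ _ _ _), h.three]
  · exact (split_coord h.prob (-1) (fun x => by tauto) (fun x => by tauto)).symm
  · rw [Set.disjoint_left]
    intro x hx hy
    simp at hx hy
    simp_all

lemma step_0 {ν : Measure (ℤ → Bool)} (h : SInv ν) :
    (ν.map (eca rule14)).real {x | x 0 = false} =
      1 - ν.real {x | x 0 = false} + ν.real {x | x 0 = false ∧ x 1 = false ∧ x 2 = false} := by
  have := h.prob
  rw [map_measureReal_apply measurable_eca14 (meas_coord _ _)]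
  have e : eca rule14 ⁻¹' {x | x 0 = false} =
      {x | x (-1) = false}ᶜ ∪ {x | x (-1) = false ∧ x 0 = false ∧ x 1 = false} := by
    ext x
    simp only [Set.mem_preimage, Set.mem_ofPred_eq, Set.mem_union, Set.mem_compl_iff]
    have y0 := eca14' x (-1) 0 1 (by ring) (by ring)
    rw [y0]
    cases x (-1) <;> cases x 0 <;> cases x 1 <;> simp
  rw [e, measureReal_union _ (meas_three _ _ _ _ _ _), measureReal_compl (meas_coord _ _),
    ← h.one, ← h.three]
  · simp
  · rw [Set.disjoint_left]
    intro x hx hy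
    simp at hx hy
    simp_all

lemma step_111 {ν : Measure (ℤ → Bool)} :
    (ν.map (eca rule14)).real {x | x 0 = true ∧ x 1 = true ∧ x 2 = true} = 0 := by
  rw [map_measureReal_apply measurable_eca14 (meas_three _ _ _ _ _ _)]
  have e : eca rule14 ⁻¹' {x | x 0 = true ∧ x 1 = true ∧ x 2 = true} = ∅ := by
    ext x
    simp only [Set.mem_preimage, Set.mem_ofPred_eq]
    have y0 := eca14' x (-1) 0 1 (by ring) (by ring)
    have y1 := eca14' x 0 1 2 (by ring) (by ring)
    have y2 := eca14' x 1 2 3 (by ring) (by ring)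
    rw [y0, y1, y2]
    cases x (-1) <;> cases x 0 <;> cases x 1 <;> simp
  rw [e]; simp

lemma rel_00 {ν : Measure (ℤ → Bool)} (h : SInv ν)
    (h01 : ν.real {x | x 0 = false ∧ x 1 = true} = 1 / 4) :
    ν.real {x | x 0 = false ∧ x 1 = false} = ν.real {x | x 0 = false} - 1 / 4 := by
  have : ν.real {x | x 0 = false} = ν.real {x | x 0 = false ∧ x 1 = true} +
      ν.real {x | x 0 = false ∧ x 1 = false} :=
    split_coord h.prob 1 (fun x => by tauto) (fun x => by tauto)
  linarith

lemma rel_0 {ν : Measure (ℤ → Bool)} (h : SInv ν)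
    (h01 : ν.real {x | x 0 = false ∧ x 1 = true} = 1 / 4)
    (h111 : ν.real {x | x 0 = true ∧ x 1 = true ∧ x 2 = true} = 0) :
    ν.real {x | x 0 = false} = 1 / 2 +
      ν.real {x | x 0 = false ∧ x 1 = true ∧ x 2 = false} := by
  have := h.prob
  have h00 := rel_00 h h01
  have a0 : ν.real {x | True} = ν.real {x | x 1 = true} + ν.real {x | x 1 = false} :=
    split_coord h.prob 1 (fun x => by tauto) (fun x => by tauto)
  have a1 : ν.real {x | x 1 = true} = ν.real {x | x 0 = true ∧ x 1 = true} +
      ν.real {x | x 0 = false ∧ x 1 = true} :=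
    split_coord h.prob 0 (fun x => by tauto) (fun x => by tauto)
  have a2 : ν.real {x | x 0 = true ∧ x 1 = true} =
      ν.real {x | x 0 = true ∧ x 1 = true ∧ x 2 = true} +
      ν.real {x | x 0 = true ∧ x 1 = true ∧ x 2 = false} :=
    split_coord h.prob 2 (fun x => by tauto) (fun x => by tauto)
  have a3 : ν.real {x | x 1 = true ∧ x 2 = false} =
      ν.real {x | x 0 = true ∧ x 1 = true ∧ x 2 = false} +
      ν.real {x | x 0 = false ∧ x 1 = true ∧ x 2 = false} :=
    split_coord h.prob 0 (fun x => by tauto) (fun x => by tauto)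
  have a4 : ν.real {x | x 2 = false} = ν.real {x | x 1 = true ∧ x 2 = false} +
      ν.real {x | x 1 = false ∧ x 2 = false} :=
    split_coord h.prob 1 (fun x => by tauto) (fun x => by tauto)
  have b1 : ν.real {x | x 1 = false} = ν.real {x | x 0 = false} := h.one 0 false
  have b2 : ν.real {x | x 2 = false} = ν.real {x | x 1 = false} := h.one 1 false
  have b3 : ν.real {x | x 1 = false ∧ x 2 = false} = ν.real {x | x 0 = false ∧ x 1 = false} := by
    have := h.three 0 0 1 false false false
    simpa using this
  have b4 : ν.real {x | True} = 1 := by simp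
  linarith

lemma iter_SInv (μ : Measure (ℤ → Bool)) (hprob : IsProbabilityMeasure μ)
    (hber : IsBernoulli (1 / 2) μ) (n : ℕ) : SInv (μ.map (eca rule14)^[n]) ∧
      (μ.map (eca rule14)^[n + 1]) = (μ.map (eca rule14)^[n]).map (eca rule14) ∧
      (μ.map (eca rule14)^[n]).real {x | x 0 = false ∧ x 1 = true} = 1 / 4 := by
  have hm : ∀ n, (μ.map (eca rule14)^[n + 1]) = (μ.map (eca rule14)^[n]).map (eca rule14) := by
    intro n
    rw [Measure.map_map measurable_eca14 (measurable_eca14.iterate n), ← Function.iterate_succ']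
  induction n with
  | zero =>
    refine ⟨⟨by simpa using hprob, by simpa using map_shZ μ hprob hber⟩, hm 0, ?_⟩
    have := ber_real μ hber {0, 1} (fun i => decide (i = 1))
    simp at this
    simp [this]
    norm_num
  | succ n ih =>
    refine ⟨by rw [hm]; exact ih.1.step, hm _, ?_⟩
    rw [hm, step_01 ih.1, ih.2.2]

lemma main_010 (μ : Measure (ℤ → Bool)) (hprob : IsProbabilityMeasure μ)
    (hber : IsBernoulli (1 / 2) μ) (n : ℕ) :
    (μ.map (eca rule14)^[n + 1]).real {x | x 0 = false ∧ x 1 = true ∧ x 2 = false} =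
      (n + 1).centralBinom / 4 ^ (n + 2) := by
  rw [map_measureReal_apply (measurable_eca14.iterate _) (meas_three _ _ _ _ _ _)]
  exact meas_010 μ hprob hber n

lemma main_0 (μ : Measure (ℤ → Bool)) (hprob : IsProbabilityMeasure μ)
    (hber : IsBernoulli (1 / 2) μ) (n : ℕ) :
    (μ.map (eca rule14)^[n + 1]).real {x | x 0 = false} =
      1 / 2 + (n + 1).centralBinom / 4 ^ (n + 2) := by
  obtain ⟨h1, -, h3⟩ := iter_SInv μ hprob hber (n + 1)
  rw [rel_0 h1 h3, main_010 μ hprob hber]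
  rw [(iter_SInv μ hprob hber n).2.1]
  exact step_111

lemma cyl1 (a : Bool) : cylinder [a] = {x | x 0 = a} := by
  ext x; simp [_root_.cylinder]

lemma cyl2 (a b : Bool) : cylinder [a, b] = {x | x 0 = a ∧ x 1 = b} := by
  ext x; simp [_root_.cylinder, Fin.forall_fin_succ]

lemma cyl3 (a b c : Bool) : cylinder [a, b, c] = {x | x 0 = a ∧ x 1 = b ∧ x 2 = c} := by
  ext x; simp [_root_.cylinder, Fin.forall_fin_succ]

lemma cat_eq (n : ℕ) : ((n : ℝ) + 1) * catalan n = n.centralBinom := by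
  exact_mod_cast succ_mul_catalan_eq_centralBinom n

/-- exact block probabilities (short block representation, lengths ≤ 3)
for ECA rule 14 started from the symmetric Bernoulli measure `μ_{1/2}`, in terms of
Catalan numbers. -/
theorem rule14_block_probabilities_half
    (μ : Measure (ℤ → Bool)) (hprob : IsProbabilityMeasure μ)
    (hber : IsBernoulli (1 / 2) μ) (n : ℕ) (hn : 1 ≤ n) :
    (μ ((eca rule14)^[n] ⁻¹' cylinder [false])).toReal
        = 1 / 2 * (1 + (2 * (n : ℝ) - 1) * (catalan (n - 1) : ℝ) / 4 ^ n) ∧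
    (μ ((eca rule14)^[n] ⁻¹' cylinder [false, false])).toReal
        = (2 : ℝ) ^ (-2 - 2 * (n : ℤ)) * ((n : ℝ) + 1) * (catalan n : ℝ) + 1 / 4 ∧
    (μ ((eca rule14)^[n] ⁻¹' cylinder [false, false, false])).toReal
        = (2 : ℝ) ^ (-2 * (n : ℤ) - 3) * (4 * (n : ℝ) + 3) * (catalan n : ℝ) ∧
    (μ ((eca rule14)^[n] ⁻¹' cylinder [false, true, false])).toReal
        = (2 : ℝ) ^ (-2 - 2 * (n : ℤ)) * ((n : ℝ) + 1) * (catalan n : ℝ) := by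
  obtain ⟨m, rfl⟩ : ∃ m, n = m + 1 := ⟨n - 1, by omega⟩
  have hmeas := measurable_eca14.iterate (m + 1)
  have conv : ∀ A, MeasurableSet A → (μ ((eca rule14)^[m + 1] ⁻¹' A)).toReal =
      (μ.map (eca rule14)^[m + 1]).real A := by
    intro A hA
    rw [map_measureReal_apply hmeas hA]; rfl
  obtain ⟨h1, h2, h3⟩ := iter_SInv μ hprob hber (m + 1)
  rw [cyl1, cyl2, cyl3, cyl3, conv _ (meas_coord _ _), conv _ (meas_two _ _ _ _),
    conv _ (meas_three _ _ _ _ _ _), conv _ (meas_three _ _ _ _ _ _)]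
  have q0 := main_0 μ hprob hber m
  have q1 := main_0 μ hprob hber (m + 1)
  have q010 := main_010 μ hprob hber m
  have q00 := rel_00 h1 h3
  have q000 := step_0 h1
  rw [← h2, q1, q0] at q000
  have r1 : (m : ℝ) + 1 ≠ 0 := by positivity
  have r2 : (m : ℝ) + 2 ≠ 0 := by positivity
  have c0 := cat_eq m
  have c1 := cat_eq (m + 1)
  have s0 : ((m : ℝ) + 1) * (m + 1).centralBinom = 2 * (2 * m + 1) * m.centralBinom := by
    exact_mod_cast Nat.succ_mul_centralBinom_succ m
  have s1 : ((m : ℝ) + 2) * (m + 1 + 1).centralBinom = 2 * (2 * m + 3) * (m + 1).centralBinom := by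
    have := Nat.succ_mul_centralBinom_succ (m + 1)
    have h : (((m + 1 + 1) * (m + 1 + 1).centralBinom : ℕ) : ℝ) =
      ((2 * (2 * (m + 1) + 1) * (m + 1).centralBinom : ℕ) : ℝ) := by rw [this]
    push_cast at h
    linear_combination h
  have e1 : (2 : ℝ) ^ (-2 - 2 * ((m + 1 : ℕ) : ℤ)) = 1 / 4 ^ (m + 2) := by
    rw [show -2 - 2 * ((m + 1 : ℕ) : ℤ) = -((2 * (m + 2) : ℕ) : ℤ) by push_cast; ring, zpow_neg,
      zpow_natCast, pow_mul]
    norm_num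
  have e2 : (2 : ℝ) ^ (-2 * ((m + 1 : ℕ) : ℤ) - 3) = 1 / (2 * 4 ^ (m + 2)) := by
    rw [show -2 * ((m + 1 : ℕ) : ℤ) - 3 = -((2 * (m + 2) + 1 : ℕ) : ℤ) by push_cast; ring,
      zpow_neg, zpow_natCast, pow_succ, pow_mul]
    norm_num
    ring
  rw [e1, e2, q00, q0, q010]
  push_cast at *
  have c0' : (m + 1).centralBinom = 2 * (2 * (m : ℝ) + 1) * catalan m := by
    apply mul_left_cancel₀ r1
    rw [s0, ← c0]; ring
  refine ⟨?_, ?_, ?_, ?_⟩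
  · rw [c0']
    field_simp
    ring
  · rw [← c1]; ring
  · have c2 : ((m + 1 + 1).centralBinom : ℝ) = 2 * (2 * m + 3) * catalan (m + 1) := by
      apply mul_left_cancel₀ r2
      rw [s1, ← c1]; ring
    rw [← c1, c2] at q000
    have : (4 : ℝ) ^ (m + 1 + 2) = 4 * 4 ^ (m + 2) := by ring
    rw [this] at q000
    have h4 : (4 : ℝ) ^ (m + 2) ≠ 0 := by positivity
    field_simp at q000 ⊢
    linarith
  · rw [← c1]; ring
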